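/- There exists an absolute constant C > 0 such that for every ε ∈ (0, 1] the following holds. Let L be a staircase path (a rectilinear polygonal path that is both x-monotone nondecreasing and y-monotone nondecreasing) and let S ⊂ L be a finite set of points. Then there exists a geometric graph E comprised of the edges of L together with additional segments of total weight at most C · ε^{−1/2} · width(L), such that for all a, b ∈ S, if the segment ab lies below L (i.e. ab ⊆ R(L)) and |x(a) − x(b)| ≤ ε^{1/2}·|y(a) − y(b)| (i.e. the slope of ab is at least ε^{−1/2} in absolute value, or ab is vertical), then there is an ab-path P in E with weight ‖P‖ ≤ (1 + C·ε)·‖a − b‖. -/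

import Mathlib

open scoped Classical

noncomputable section

/-- The Euclidean plane. -/
abbrev Plane : Type := EuclideanSpace ℝ (Fin 2)

/-- The point `(x, y) ∈ ℝ²`. -/
def pt (x y : ℝ) : Plane := (EuclideanSpace.equiv (Fin 2) ℝ).symm ![x, y]

/-- The union of the segments of a geometric graph. -/
def segUnion (E : Finset (Plane × Plane)) : Set Plane :=
  ⋃ e ∈ E, segment ℝ e.1 e.2

/-- The total weight of a geometric graph: the sum of the Euclidean lengths of its
segments. -/
def gweight (E : Finset (Plane × Plane)) : ℝ :=
  ∑ e ∈ E, ‖e.1 - e.2‖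

/-- `HasPath E s t w` : there is a polygonal path from `s` to `t`, each of whose edges is
contained in the union of the segments of `E`, of weight at most `w`. -/
def HasPath (E : Finset (Plane × Plane)) (s t : Plane) (w : ℝ) : Prop :=
  ∃ (m : ℕ) (v : ℕ → Plane), v 0 = s ∧ v m = t ∧
    (∀ i < m, segment ℝ (v i) (v (i + 1)) ⊆ segUnion E) ∧
    ∑ i ∈ Finset.range m, ‖v (i + 1) - v i‖ ≤ w

/-- A rectilinear path: every edge is horizontal or vertical. -/
def IsRectilinear (n : ℕ) (u : ℕ → Plane) : Prop :=
  ∀ i < n, u i 0 = u (i + 1) 0 ∨ u i 1 = u (i + 1) 1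

/-- The set of points of the polygonal path with vertices `u 0, …, u n`. -/
def pathSet (n : ℕ) (u : ℕ → Plane) : Set Plane :=
  ⋃ i ∈ Finset.range n, segment ℝ (u i) (u (i + 1))

/-- The edges of the polygonal path with vertices `u 0, …, u n`, as a geometric graph. -/
def pathEdges (n : ℕ) (u : ℕ → Plane) : Finset (Plane × Plane) :=
  (Finset.range n).image fun i => (u i, u (i + 1))

/-- A staircase path: a rectilinear path that is both `x`-monotone nondecreasing and
`y`-monotone nondecreasing. -/
def IsStaircase (n : ℕ) (u : ℕ → Plane) : Prop :=
  IsRectilinear n u ∧ ∀ i < n, u i 0 ≤ u (i + 1) 0 ∧ u i 1 ≤ u (i + 1) 1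

/-- The region below an `x`-monotone path with point set `L` : points `p` that lie
vertically below some point of `L` and not below the lowest point of `L`. -/
def belowRegion (L : Set Plane) : Set Plane :=
  {p | (∃ q ∈ L, q 0 = p 0 ∧ p 1 ≤ q 1) ∧ (∃ q ∈ L, q 1 ≤ p 1)}

/-! ### Coordinates, segments and weights -/

@[simp] lemma pt_zero (x y : ℝ) : pt x y 0 = x := by simp [pt]

@[simp] lemma pt_one (x y : ℝ) : pt x y 1 = y := by simp [pt]

lemma plane_ext {p q : Plane} (h0 : p 0 = q 0) (h1 : p 1 = q 1) : p = q := by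
  ext i
  fin_cases i
  · exact h0
  · exact h1

lemma norm_sub_sq_eq_coord (p q : Plane) :
    ‖p - q‖ ^ 2 = (p 0 - q 0) ^ 2 + (p 1 - q 1) ^ 2 := by
  rw [EuclideanSpace.norm_sq_eq]
  simp

lemma sub_coord_one_le_norm (p q : Plane) : p 1 - q 1 ≤ ‖p - q‖ := by
  refine le_of_sq_le_sq ?_ (norm_nonneg _)
  rw [norm_sub_sq_eq_coord]
  nlinarith [sq_nonneg (p 0 - q 0)]

lemma norm_sub_le_coord_add {p q : Plane} (h0 : q 0 ≤ p 0) (h1 : q 1 ≤ p 1) :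
    ‖p - q‖ ≤ (p 1 - q 1) + (p 0 - q 0) := by
  refine le_of_sq_le_sq ?_ (by linarith)
  rw [norm_sub_sq_eq_coord]
  nlinarith [mul_nonneg (sub_nonneg.2 h0) (sub_nonneg.2 h1)]

/-- A segment of slope at least `s` is longer than its height by at most `1 / s` times its
width. -/
lemma norm_sub_le_of_steep {p q : Plane} {s : ℝ} (hs : 0 < s) (h0 : q 0 ≤ p 0)
    (h1 : s * (p 0 - q 0) ≤ p 1 - q 1) :
    ‖p - q‖ ≤ (p 1 - q 1) + (p 0 - q 0) / s := by
  have hx : 0 ≤ p 0 - q 0 := sub_nonneg.2 h0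
  have hd : 0 ≤ (p 0 - q 0) / s := div_nonneg hx hs.le
  have hy : 0 ≤ p 1 - q 1 := (mul_nonneg hs.le hx).trans h1
  refine le_of_sq_le_sq ?_ (by linarith)
  rw [norm_sub_sq_eq_coord]
  have h2 : s * ((p 0 - q 0) / s) = p 0 - q 0 := by field_simp
  generalize (p 0 - q 0) / s = d at *
  rw [← h2] at h1 ⊢
  nlinarith [mul_nonneg (sub_nonneg.2 h1) hd, mul_nonneg (mul_nonneg hs.le hd) hd, sq_nonneg d,
    mul_nonneg (mul_nonneg hs.le hs.le) (mul_nonneg hd hd)]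

lemma mem_segment_of_coord {p q z : Plane} (t : ℝ) (ht0 : 0 ≤ t) (ht1 : t ≤ 1)
    (h0 : z 0 = p 0 + t * (q 0 - p 0)) (h1 : z 1 = p 1 + t * (q 1 - p 1)) :
    z ∈ segment ℝ p q := by
  refine ⟨1 - t, t, by linarith, ht0, by ring, plane_ext ?_ ?_⟩
  · simp [h0]; ring
  · simp [h1]; ring

lemma coord_of_mem_segment {p q z : Plane} (h : z ∈ segment ℝ p q) :
    ∃ t : ℝ, 0 ≤ t ∧ t ≤ 1 ∧ z 0 = p 0 + t * (q 0 - p 0) ∧ z 1 = p 1 + t * (q 1 - p 1) := by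
  obtain ⟨a, b, ha, hb, hab, rfl⟩ := h
  obtain rfl : a = 1 - b := by linarith
  refine ⟨b, hb, by linarith, ?_, ?_⟩ <;> simp <;> ring

lemma coord_mem_of_mem_segment {p q z : Plane} (h : z ∈ segment ℝ p q) (h0 : p 0 ≤ q 0)
    (h1 : p 1 ≤ q 1) : (p 0 ≤ z 0 ∧ z 0 ≤ q 0) ∧ p 1 ≤ z 1 ∧ z 1 ≤ q 1 := by
  obtain ⟨t, ht0, ht1, hz0, hz1⟩ := coord_of_mem_segment h
  rw [hz0, hz1]
  refine ⟨⟨?_, ?_⟩, ?_, ?_⟩ <;> nlinarith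

/-- A point of a vertical line between two points of the line lies on their segment. -/
lemma mem_segment_vertical {p q z : Plane} (h : p 0 = q 0) (hz : z 0 = p 0) (h1 : p 1 ≤ z 1)
    (h2 : z 1 ≤ q 1) : z ∈ segment ℝ p q := by
  rcases eq_or_lt_of_le (h1.trans h2) with he | hl
  · exact mem_segment_of_coord 0 le_rfl zero_le_one (by rw [hz]; ring) (by linarith)
  · have hpos : 0 < q 1 - p 1 := sub_pos.2 hl
    refine mem_segment_of_coord ((z 1 - p 1) / (q 1 - p 1)) (div_nonneg (by linarith) hpos.le)
      ((div_le_one hpos).2 (by linarith)) (by rw [hz, h]; ring) ?_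
    field_simp
    ring

lemma segment_subset_segment {p q a b : Plane} (ha : a ∈ segment ℝ p q)
    (hb : b ∈ segment ℝ p q) : segment ℝ a b ⊆ segment ℝ p q :=
  (convex_segment p q).segment_subset ha hb

lemma segUnion_union (A B : Finset (Plane × Plane)) :
    segUnion (A ∪ B) = segUnion A ∪ segUnion B := by
  ext z
  simp only [segUnion, Set.mem_iUnion, Set.mem_union, Finset.mem_union, exists_prop]
  constructor
  · rintro ⟨e, he | he, hz⟩
    exacts [Or.inl ⟨e, he, hz⟩, Or.inr ⟨e, he, hz⟩]
  · rintro (⟨e, he, hz⟩ | ⟨e, he, hz⟩)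
    exacts [⟨e, Or.inl he, hz⟩, ⟨e, Or.inr he, hz⟩]

lemma segment_subset_segUnion_singleton (p q : Plane) :
    segment ℝ p q ⊆ segUnion {(p, q)} := by
  simp [segUnion]

lemma gweight_union_le (A B : Finset (Plane × Plane)) :
    gweight (A ∪ B) ≤ gweight A + gweight B := by
  unfold gweight
  rw [← Finset.sum_union_inter]
  exact le_add_of_nonneg_right (Finset.sum_nonneg fun _ _ => norm_nonneg _)

@[simp] lemma gweight_empty : gweight ∅ = 0 := by simp [gweight]

@[simp] lemma gweight_singleton (p q : Plane) : gweight {(p, q)} = ‖p - q‖ := by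
  simp [gweight]

lemma segUnion_pathEdges (n : ℕ) (u : ℕ → Plane) : segUnion (pathEdges n u) = pathSet n u := by
  ext z
  simp [segUnion, pathEdges, pathSet]

/-! ### Paths in geometric graphs -/

lemma HasPath.symm {E : Finset (Plane × Plane)} {p q : Plane} {w : ℝ} (h : HasPath E p q w) :
    HasPath E q p w := by
  obtain ⟨m, v, h0, hm, hseg, hw⟩ := h
  refine ⟨m, fun i => v (m - i), by simpa using hm, by simpa using h0, fun i hi => ?_, ?_⟩
  · have he : m - i = m - (i + 1) + 1 := by omega
    have := hseg (m - (i + 1)) (by omega)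
    rw [segment_symm, ← he] at this
    exact this
  · rw [← Finset.sum_range_reflect] at hw
    refine le_of_eq_of_le (Finset.sum_congr rfl fun i hi => ?_) hw
    have hi := Finset.mem_range.1 hi
    have h1 : m - i = m - 1 - i + 1 := by omega
    have h2 : m - (i + 1) = m - 1 - i := by omega
    simp only [h1, h2]
    exact norm_sub_rev _ _

/-- `Descends U p q e`: there is a polygonal path in `U` from `p` to `q` along which both
coordinates are nonincreasing, of length at most `e` more than its height. -/
inductive Descends (U : Set Plane) : Plane → Plane → ℝ → Prop
  | refl (p : Plane) {e : ℝ} (he : 0 ≤ e) : Descends U p p e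
  | step {p q r : Plane} {e f : ℝ} (hseg : segment ℝ p q ⊆ U) (h0 : q 0 ≤ p 0)
      (h1 : q 1 ≤ p 1) (hn : ‖p - q‖ ≤ (p 1 - q 1) + e) (hd : Descends U q r f) :
      Descends U p r (e + f)

namespace Descends

variable {U V : Set Plane} {p q r : Plane} {e f : ℝ}

lemma excess_nonneg_of_norm_le (hn : ‖p - q‖ ≤ (p 1 - q 1) + e) : 0 ≤ e := by
  linarith [sub_coord_one_le_norm p q]

lemma excess_nonneg (h : Descends U p q e) : 0 ≤ e := by
  induction h with
  | refl _ he => exact he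
  | step _ _ _ hn _ ih => exact add_nonneg (excess_nonneg_of_norm_le hn) ih

lemma mono (h : Descends U p q e) (hUV : U ⊆ V) : Descends V p q e := by
  induction h with
  | refl p he => exact .refl p he
  | step hseg h0 h1 hn _ ih => exact .step (hseg.trans hUV) h0 h1 hn ih

lemma weaken (h : Descends U p q e) (hef : e ≤ f) : Descends U p q f := by
  induction h generalizing f with
  | refl p he => exact .refl p (he.trans hef)
  | @step p q r e e' hseg h0 h1 hn _ ih =>
    have := Descends.step hseg h0 h1 hn (ih (f := f - e) (by linarith))
    rwa [add_sub_cancel] at this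

lemma trans (h : Descends U p q e) (h' : Descends U q r f) : Descends U p r (e + f) := by
  induction h with
  | refl p he => exact h'.weaken (by linarith)
  | step hseg h0 h1 hn _ ih =>
    rw [add_assoc]
    exact .step hseg h0 h1 hn (ih h')

lemma single (hseg : segment ℝ p q ⊆ U) (h0 : q 0 ≤ p 0) (h1 : q 1 ≤ p 1)
    (hn : ‖p - q‖ ≤ (p 1 - q 1) + e) : Descends U p q e := by
  simpa using Descends.step hseg h0 h1 hn (.refl q le_rfl)

lemma vertical (hseg : segment ℝ p q ⊆ U) (h0 : q 0 = p 0) (h1 : q 1 ≤ p 1) :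
    Descends U p q 0 :=
  single hseg h0.le h1 ((norm_sub_le_coord_add h0.le h1).trans (by linarith))

lemma steep {s : ℝ} (hs : 0 < s) (hseg : segment ℝ p q ⊆ U) (h0 : q 0 ≤ p 0)
    (h1 : s * (p 0 - q 0) ≤ p 1 - q 1) : Descends U p q ((p 0 - q 0) / s) :=
  single hseg h0 (by nlinarith [mul_nonneg hs.le (sub_nonneg.2 h0)])
    (norm_sub_le_of_steep hs h0 h1)

lemma coord_zero_le (h : Descends U p q e) : q 0 ≤ p 0 := by
  induction h with
  | refl => exact le_rfl
  | step _ h0 _ _ _ ih => exact ih.trans h0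

lemma hasPath {E : Finset (Plane × Plane)} (h : Descends (segUnion E) p q e) :
    HasPath E p q ((p 1 - q 1) + e) := by
  induction h with
  | refl p he => exact ⟨0, fun _ => p, rfl, rfl, by simp, by simpa using he⟩
  | @step p q r e f hseg h0 h1 hn _ ih =>
    obtain ⟨m, v, hv0, hvm, hvseg, hw⟩ := ih
    refine ⟨m + 1, fun i => Nat.casesOn i p v, rfl, hvm, fun i hi => ?_, ?_⟩
    · cases i with
      | zero => simpa [hv0] using hseg
      | succ i => exact hvseg i (by omega)
    · rw [Finset.sum_range_succ']
      change ∑ i ∈ Finset.range m, ‖v (i + 1) - v i‖ + ‖v 0 - p‖ ≤ _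
      rw [hv0, norm_sub_rev q p]
      linarith

/-- A descending path from above to below a line of slope `s` crosses that line. -/
lemma exists_crossing (h : Descends U p q e) (s c : ℝ) (hp : c ≤ p 1 - s * p 0)
    (hq : q 1 - s * q 0 ≤ c) :
    ∃ z, Descends U p z e ∧ z 1 - s * z 0 = c ∧ q 0 ≤ z 0 := by
  induction h with
  | refl p he => exact ⟨p, .refl p he, le_antisymm hq hp, le_rfl⟩
  | @step p q r e f hseg h0 h1 hn hd ih =>
    rcases le_total c (q 1 - s * q 0) with hc | hc
    · obtain ⟨z, hz, hz1, hz2⟩ := ih hc hq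
      exact ⟨z, .step hseg h0 h1 hn hz, hz1, hz2⟩
    · obtain ⟨t, ht0, ht1, ht⟩ : ∃ t : ℝ, 0 ≤ t ∧ t ≤ 1 ∧
          (p 1 - s * p 0) + t * ((q 1 - s * q 0) - (p 1 - s * p 0)) = c := by
        rcases eq_or_lt_of_le (hc.trans hp) with he | hl
        · exact ⟨0, le_rfl, zero_le_one, by linarith⟩
        · have hpos : 0 < (p 1 - s * p 0) - (q 1 - s * q 0) := sub_pos.2 hl
          refine ⟨((p 1 - s * p 0) - c) / ((p 1 - s * p 0) - (q 1 - s * q 0)),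
            div_nonneg (by linarith) hpos.le, (div_le_one hpos).2 (by linarith), ?_⟩
          field_simp
          ring
      have hz : pt (p 0 + t * (q 0 - p 0)) (p 1 + t * (q 1 - p 1)) ∈ segment ℝ p q :=
        mem_segment_of_coord t ht0 ht1 (by simp) (by simp)
      have hnorm : ‖p - pt (p 0 + t * (q 0 - p 0)) (p 1 + t * (q 1 - p 1))‖ = t * ‖p - q‖ := by
        rw [← abs_of_nonneg ht0, ← Real.norm_eq_abs, ← norm_smul, Real.norm_eq_abs,
          abs_of_nonneg ht0]
        congr 1
        apply plane_ext <;> simp <;> ring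
      refine ⟨pt (p 0 + t * (q 0 - p 0)) (p 1 + t * (q 1 - p 1)), weaken (e := e) (single
        ((segment_subset_segment (left_mem_segment ℝ p q) hz).trans hseg) ?_ ?_ ?_)
        (by linarith [hd.excess_nonneg]), ?_, ?_⟩
      · simp; nlinarith
      · simp; nlinarith
      · have he := excess_nonneg_of_norm_le hn
        rw [hnorm, pt_one]
        nlinarith
      · simp; linarith
      · simp; nlinarith [hd.coord_zero_le]

end Descends

/-! ### Staircases -/

/-- An infinite sequence of points whose consecutive points are joined by horizontal or
vertical segments in `U`, both coordinates being nondecreasing. -/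
structure StairSeq (P : ℕ → Plane) (U : Set Plane) : Prop where
  segment_subset : ∀ i, segment ℝ (P i) (P (i + 1)) ⊆ U
  coord_zero_le : ∀ i, P i 0 ≤ P (i + 1) 0
  coord_one_le : ∀ i, P i 1 ≤ P (i + 1) 1
  rectilinear : ∀ i, P i 0 = P (i + 1) 0 ∨ P i 1 = P (i + 1) 1

namespace StairSeq

variable {P : ℕ → Plane} {U : Set Plane}

lemma mono_zero (h : StairSeq P U) {i j : ℕ} (hij : i ≤ j) : P i 0 ≤ P j 0 :=
  monotone_nat_of_le_succ (f := fun i => P i 0) h.coord_zero_le hij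

lemma mono_one (h : StairSeq P U) {i j : ℕ} (hij : i ≤ j) : P i 1 ≤ P j 1 :=
  monotone_nat_of_le_succ (f := fun i => P i 1) h.coord_one_le hij

/-- Walking down along the staircase. -/
lemma descends (h : StairSeq P U) {i k : ℕ} (hik : i ≤ k) :
    Descends U (P k) (P i) (P k 0 - P i 0) := by
  induction k, hik using Nat.le_induction with
  | base => exact .refl _ (by simp)
  | succ k hik ih =>
    have := Descends.step (by rw [segment_symm]; exact h.segment_subset k) (h.coord_zero_le k)
      (h.coord_one_le k) (norm_sub_le_coord_add (h.coord_zero_le k) (h.coord_one_le k)) ih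
    exact this.weaken (by linarith)

/-- A sequence that passes a threshold does so between two consecutive indices. -/
lemma exists_split (P : ℕ → Plane) {i k : ℕ} (hik : i ≤ k) {c : ℝ} (hi : P i 0 ≤ c)
    (hk : c < P k 0) : ∃ m, i ≤ m ∧ m < k ∧ P m 0 ≤ c ∧ c < P (m + 1) 0 := by
  induction k, hik using Nat.le_induction with
  | base => exact absurd hi (not_le.2 hk)
  | succ k hik ih =>
    rcases le_or_gt (P k 0) c with hc | hc
    · exact ⟨k, hik, k.lt_succ_self, hc, hk⟩
    · obtain ⟨m, h1, h2, h3⟩ := ih hc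
      exact ⟨m, h1, by omega, h3⟩

/-- From a point below `P k`, one can descend with slopes at least `s` to the vertical line
through `P i`. -/
lemma exists_chain (h : StairSeq P U) {s : ℝ} (hs : 0 < s) {i k : ℕ} (hik : i ≤ k) :
    ∀ z : Plane, z 0 = P k 0 → z 1 ≤ P k 1 →
      ∃ Ex : Finset (Plane × Plane), gweight Ex ≤ (1 + s) * (P k 0 - P i 0) ∧
        ∃ t : Plane, t 0 = P i 0 ∧ t 1 ≤ P i 1 ∧
          P i 1 - t 1 ≤ (P k 1 - z 1) + s * (P k 0 - P i 0) ∧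
          Descends (U ∪ segUnion Ex) z t ((P k 0 - P i 0) / s) := by
  induction k, hik using Nat.le_induction with
  | base =>
    intro z hz0 hz1
    exact ⟨∅, by simp, z, hz0, hz1, by linarith, .refl z (by simp)⟩
  | succ k hik ih =>
    intro z hz0 hz1
    have hx := h.mono_zero hik
    have hy := h.coord_one_le k
    by_cases hv : P k 0 = P (k + 1) 0
    · rcases le_total (z 1) (P k 1) with hzk | hzk
      · obtain ⟨Ex, hw, t, ht0, ht1, hd, hp⟩ := ih z (by rw [hz0, hv]) hzk
        exact ⟨Ex, by rwa [← hv], t, ht0, ht1, by rw [← hv]; linarith, by rwa [← hv]⟩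
      · obtain ⟨Ex, hw, t, ht0, ht1, hd, hp⟩ := ih (P k) rfl le_rfl
        refine ⟨Ex, by rwa [← hv], t, ht0, ht1, by rw [← hv]; linarith, ?_⟩
        rw [← hv, ← zero_add ((P k 0 - P i 0) / s)]
        refine .trans (.vertical ?_ (by rw [hz0, hv]) hzk) hp
        refine (Set.Subset.trans ?_ (h.segment_subset k)).trans Set.subset_union_left
        exact segment_subset_segment (mem_segment_vertical hv (by rw [hz0, hv]) hzk hz1)
          (left_mem_segment ℝ _ _)
    · have hyk := (h.rectilinear k).resolve_left hv
      have hdx : 0 ≤ P (k + 1) 0 - P k 0 := sub_nonneg.2 (h.coord_zero_le k)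
      set z' : Plane := pt (P k 0) (z 1 - s * (P (k + 1) 0 - P k 0)) with hz'
      have hsd := mul_nonneg hs.le hdx
      obtain ⟨Ex, hw, t, ht0, ht1, hd, hp⟩ := ih z' (by simp [hz']) (by simp [hz']; linarith)
      have hz'0 : z' 0 = P k 0 := by simp [hz']
      have hz'1 : z' 1 = z 1 - s * (P (k + 1) 0 - P k 0) := by simp [hz']
      refine ⟨{(z, z')} ∪ Ex, ?_, t, ht0, ht1, ?_, ?_⟩
      · refine (gweight_union_le _ _).trans ?_
        rw [gweight_singleton]
        have := norm_sub_le_coord_add (p := z) (q := z') (by rw [hz'0, hz0]; linarith)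
          (by linarith)
        rw [hz'0, hz'1, hz0] at this
        linarith
      · rw [hz'1] at hd
        linarith
      · have hst : Descends (U ∪ segUnion ({(z, z')} ∪ Ex)) z z' ((z 0 - z' 0) / s) := by
          refine .steep hs ?_ (by rw [hz'0, hz0]; linarith) (by rw [hz'0, hz'1, hz0]; linarith)
          rw [segUnion_union]
          exact (segment_subset_segUnion_singleton z z').trans
            (Set.subset_union_left.trans Set.subset_union_right)
        refine (hst.trans (hp.mono ?_)).weaken ?_
        · rw [segUnion_union]
          exact Set.union_subset_union_right _ Set.subset_union_right
        · rw [hz'0, hz0, ← add_div]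
          apply le_of_eq
          congr 1
          ring

/-- From all points at most `h` below `P k`, one can descend with slopes at least `s` to a
common point of the vertical line through `P i`. -/
lemma exists_drop_chain (hP : StairSeq P U) {s h : ℝ} (hs : 0 < s) (hh : 0 ≤ h) {i k : ℕ}
    (hik : i ≤ k) :
    ∃ Ex : Finset (Plane × Plane), gweight Ex ≤ h + (1 + s) * (P k 0 - P i 0) ∧
      ∃ t : Plane, t 0 = P i 0 ∧ t 1 ≤ P i 1 ∧ P i 1 - t 1 ≤ h + s * (P k 0 - P i 0) ∧
        ∀ z : Plane, z 0 = P k 0 → z 1 ≤ P k 1 → P k 1 - z 1 ≤ h →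
          Descends (U ∪ segUnion Ex) z t ((P k 0 - P i 0) / s) := by
  set b : Plane := pt (P k 0) (P k 1 - h) with hb
  have hb0 : b 0 = P k 0 := by simp [hb]
  have hb1 : b 1 = P k 1 - h := by simp [hb]
  obtain ⟨Ex, hw, t, ht0, ht1, hd, hp⟩ := hP.exists_chain hs hik b hb0 (by linarith)
  refine ⟨{(P k, b)} ∪ Ex, ?_, t, ht0, ht1, by rw [hb1] at hd; linarith, fun z hz0 hz1 hz => ?_⟩
  · refine (gweight_union_le _ _).trans ?_
    rw [gweight_singleton]
    have := norm_sub_le_coord_add (p := P k) (q := b) hb0.le (by linarith)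
    linarith
  · rw [← zero_add ((P k 0 - P i 0) / s), segUnion_union]
    refine .trans (.vertical ?_ (by rw [hb0, hz0]) (by linarith)) (hp.mono ?_)
    · refine Set.Subset.trans ?_ ((segment_subset_segUnion_singleton (P k) b).trans
        (Set.subset_union_left.trans Set.subset_union_right))
      refine segment_subset_segment ?_ (right_mem_segment ℝ _ _)
      rw [segment_symm]
      exact mem_segment_vertical hb0 (by rw [hz0, hb0]) (by linarith) hz1
    · exact Set.union_subset_union_right _ Set.subset_union_right

/-- Shallow-light trees: all points of a piece of width at most `w` can descend to the
vertical line through its first point with excess `O(w / s)`, using weight `O(s * w)`. -/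
lemma exists_shallow_light (hP : StairSeq P U) (j : ℕ) :
    ∀ (s w : ℝ) (i k : ℕ), 0 < s → s ≤ (4 / 3) ^ j → i ≤ k → P k 0 - P i 0 ≤ w →
      ∃ Ex : Finset (Plane × Plane), gweight Ex ≤ 12 * s * w ∧
        ∀ m, i ≤ m → m ≤ k → ∃ t : Plane, t 0 = P i 0 ∧ t 1 ≤ P i 1 ∧
          P i 1 - t 1 ≤ 2 * s * w ∧ Descends (U ∪ segUnion Ex) (P m) t (3 * w / s) := by
  have walk : ∀ (s w : ℝ) (i k : ℕ), 0 < s → s ≤ 1 → i ≤ k → P k 0 - P i 0 ≤ w →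
      ∃ Ex : Finset (Plane × Plane), gweight Ex ≤ 12 * s * w ∧
        ∀ m, i ≤ m → m ≤ k → ∃ t : Plane, t 0 = P i 0 ∧ t 1 ≤ P i 1 ∧
          P i 1 - t 1 ≤ 2 * s * w ∧ Descends (U ∪ segUnion Ex) (P m) t (3 * w / s) := by
    intro s w i k hs hs1 hik hw
    have hw0 : 0 ≤ w := by linarith [hP.mono_zero hik]
    refine ⟨∅, by simp; positivity, fun m him hmk => ⟨P i, rfl, le_rfl, by simp; positivity, ?_⟩⟩
    refine ((hP.descends him).mono Set.subset_union_left).weaken ?_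
    rw [le_div_iff₀ hs]
    nlinarith [hP.mono_zero hmk, hP.mono_zero him]
  induction j with
  | zero =>
    intro s w i k hs hs1 hik hw
    exact walk s w i k hs (by simpa using hs1) hik hw
  | succ j ih =>
    intro s w i k hs hsj hik hw
    rcases le_or_gt s 1 with hs1 | hs1
    · exact walk s w i k hs hs1 hik hw
    have hw0 : 0 ≤ w := by linarith [hP.mono_zero hik]
    have hs' : 0 < 3 / 4 * s := by linarith
    have hsj' : 3 / 4 * s ≤ (4 / 3) ^ j := by rw [pow_succ] at hsj; linarith
    have hsw : 0 ≤ s * w := mul_nonneg hs.le hw0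
    have hex : 3 * (w / 2) / (3 / 4 * s) = 2 * (w / s) := by field_simp; ring
    have hex' : 3 * w / s = 3 * (w / s) := by ring
    have hws : 0 ≤ w / s := div_nonneg hw0 hs.le
    rcases le_or_gt (P k 0) (P i 0 + w / 2) with hc | hc
    · obtain ⟨Ex, hE, h⟩ := ih (3 / 4 * s) (w / 2) i k hs' hsj' hik (by linarith)
      refine ⟨Ex, by nlinarith, fun m him hmk => ?_⟩
      obtain ⟨t, ht0, ht1, ht2, hd⟩ := h m him hmk
      exact ⟨t, ht0, ht1, by nlinarith, hd.weaken (by rw [hex, hex']; linarith)⟩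
    · obtain ⟨l, hil, hlk, hl1, hl2⟩ := exists_split P hik (by linarith) hc
      obtain ⟨E₁, hE₁, h₁⟩ := ih (3 / 4 * s) (w / 2) i l hs' hsj' hil (by linarith)
      obtain ⟨E₂, hE₂, h₂⟩ := ih (3 / 4 * s) (w / 2) (l + 1) k hs' hsj' hlk (by linarith)
      have hlw : P (l + 1) 0 - P i 0 ≤ w := by linarith [hP.mono_zero (show l + 1 ≤ k from hlk)]
      obtain ⟨E₃, hE₃, t, ht0, ht1, ht2, h₃⟩ := hP.exists_drop_chain
        (h := 2 * (3 / 4 * s) * (w / 2)) hs (by nlinarith) (show i ≤ l + 1 by omega)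
      have hslw := mul_le_mul_of_nonneg_left hlw hs.le
      refine ⟨E₁ ∪ (E₂ ∪ E₃), ?_, fun m him hmk => ?_⟩
      · have := gweight_union_le E₁ (E₂ ∪ E₃)
        have := gweight_union_le E₂ E₃
        nlinarith
      · rw [segUnion_union, segUnion_union]
        rcases le_or_gt m l with hml | hml
        · obtain ⟨t, ht0, ht1, ht2, hd⟩ := h₁ m him hml
          refine ⟨t, ht0, ht1, by nlinarith, (hd.mono ?_).weaken (by rw [hex, hex']; linarith)⟩
          exact Set.union_subset_union_right _ Set.subset_union_left
        · obtain ⟨z, hz0, hz1, hz2, hd⟩ := h₂ m hml hmk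
          refine ⟨t, ht0, ht1, by nlinarith, ?_⟩
          refine ((hd.mono ?_).trans ((h₃ z hz0 hz1 hz2).mono ?_)).weaken ?_
          · exact Set.union_subset_union_right _
              (Set.subset_union_left.trans Set.subset_union_right)
          · exact Set.union_subset_union_right _
              (Set.subset_union_right.trans Set.subset_union_right)
          · rw [hex, hex']
            have := div_le_div_of_nonneg_right hlw hs.le
            linarith

/-- All points of a piece can descend to the vertical line through its first point with
excess proportional to their distance from this line. -/
lemma exists_descent_to_line (hP : StairSeq P U) {s : ℝ} (hs : 1 ≤ s) (i k : ℕ) (hik : i ≤ k) :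
    ∃ Ex : Finset (Plane × Plane), gweight Ex ≤ 18 * s * (P k 0 - P i 0) ∧
      ∀ m, i ≤ m → m ≤ k → ∃ t : Plane, t 0 = P i 0 ∧ t 1 ≤ P i 1 ∧
        Descends (U ∪ segUnion Ex) (P m) t (5 * (P m 0 - P i 0) / s) := by
  have hs0 : 0 < s := by linarith
  induction k using Nat.strong_induction_on with
  | _ k ih =>
  rcases eq_or_lt_of_le (hP.mono_zero hik) with he | hlt
  · refine ⟨∅, by simp [he], fun m him hmk => ⟨P i, rfl, le_rfl, ?_⟩⟩
    have h1 := hP.mono_zero him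
    have h2 := hP.mono_zero hmk
    have h3 : P m 0 - P i 0 = 0 := by linarith
    have := hP.descends him
    rw [h3] at this ⊢
    exact (this.mono Set.subset_union_left).weaken (by simp)
  · set w := P k 0 - P i 0 with hw
    have hw0 : 0 < w := sub_pos.2 hlt
    obtain ⟨l, hil, hlk, hl1, hl2⟩ := exists_split P hik (c := P i 0 + w / 2) (by linarith)
      (by linarith)
    obtain ⟨j, hj⟩ := pow_unbounded_of_one_lt s (show (1 : ℝ) < 4 / 3 by norm_num)
    obtain ⟨E₁, hE₁, h₁⟩ := ih l hlk hil
    obtain ⟨E₂, hE₂, h₂⟩ := hP.exists_shallow_light j s (w / 2) (l + 1) k hs0 hj.le hlk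
      (by linarith)
    have hlw : P (l + 1) 0 - P i 0 ≤ w := by linarith [hP.mono_zero (show l + 1 ≤ k from hlk)]
    obtain ⟨E₃, hE₃, t, ht0, ht1, -, h₃⟩ := hP.exists_drop_chain (h := 2 * s * (w / 2)) hs0
      (by positivity) (show i ≤ l + 1 by omega)
    refine ⟨E₁ ∪ (E₂ ∪ E₃), ?_, fun m him hmk => ?_⟩
    · have := gweight_union_le E₁ (E₂ ∪ E₃)
      have := gweight_union_le E₂ E₃
      have h4 : P l 0 - P i 0 ≤ w / 2 := by linarith
      have h5 := mul_le_mul_of_nonneg_left h4 hs0.le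
      have h6 := mul_le_mul_of_nonneg_left hlw (show 0 ≤ 1 + s by linarith)
      nlinarith
    · rw [segUnion_union, segUnion_union]
      rcases le_or_gt m l with hml | hml
      · obtain ⟨t, ht0, ht1, hd⟩ := h₁ m him hml
        exact ⟨t, ht0, ht1, hd.mono (Set.union_subset_union_right _ Set.subset_union_left)⟩
      · obtain ⟨z, hz0, hz1, hz2, hd⟩ := h₂ m hml hmk
        refine ⟨t, ht0, ht1, ?_⟩
        refine ((hd.mono ?_).trans ((h₃ z hz0 hz1 hz2).mono ?_)).weaken ?_
        · exact Set.union_subset_union_right _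
            (Set.subset_union_left.trans Set.subset_union_right)
        · exact Set.union_subset_union_right _
            (Set.subset_union_right.trans Set.subset_union_right)
        · rw [← add_div]
          refine div_le_div_of_nonneg_right ?_ hs0.le
          linarith [hP.mono_zero (show l + 1 ≤ m from hml)]

/-- Every subpath has a spanner of weight `O(min (s * width) height)` for the pairs `a ≤ b`
such that all points from `P a` to `P b` lie above the line of slope `s` through `P a`. -/
lemma exists_spanner (hP : StairSeq P U) {s : ℝ} (hs : 1 ≤ s) (n : ℕ) :
    ∀ i k : ℕ, i ≤ k → k ≤ i + n →
      ∃ Ex : Finset (Plane × Plane), gweight Ex ≤ 40 * s * (P k 0 - P i 0) ∧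
        gweight Ex ≤ 40 * (P k 1 - P i 1) ∧
        ∀ a b, i ≤ a → a ≤ b → b ≤ k →
          (∀ m, a ≤ m → m ≤ b → P a 1 - s * P a 0 ≤ P m 1 - s * P m 0) →
          Descends (U ∪ segUnion Ex) (P b) (P a) (7 * (P b 0 - P a 0) / s) := by
  have hs0 : 0 < s := by linarith
  induction n with
  | zero =>
    intro i k hik hki
    obtain rfl : k = i := by omega
    refine ⟨∅, by simp, by simp, fun a b ha hab hb _ => ?_⟩
    obtain rfl : a = b := by omega
    exact .refl _ (by simp)
  | succ n ih =>
    intro i k hik hki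
    by_cases hroot : ∀ m, i ≤ m → m ≤ k → P i 1 - s * P i 0 ≤ P m 1 - s * P m 0
    · rcases eq_or_lt_of_le hik with rfl | hlt
      · exact ih i i le_rfl (by omega)
      have hik1 := hroot k hik le_rfl
      have hikx := hP.mono_zero hik
      let Q : ℕ → Prop := fun m => i ≤ m ∧ P m 1 - s / 2 * P m 0 ≤ P k 1 - s / 2 * P k 0
      have hQi : Q i := ⟨le_rfl, by nlinarith⟩
      set l := Nat.findGreatest Q (k - 1) with hl
      have hlk : l < k := by have := Nat.findGreatest_le (P := Q) (k - 1); omega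
      obtain ⟨hil, hlQ⟩ : Q l := Nat.findGreatest_spec (m := i) (by omega) hQi
      have habove : ∀ m, l < m → m ≤ k → P k 1 - s / 2 * P k 0 ≤ P m 1 - s / 2 * P m 0 := by
        intro m hlm hmk
        rcases eq_or_lt_of_le hmk with rfl | hmk
        · exact le_rfl
        · by_contra! hcon
          exact Nat.findGreatest_is_greatest (P := Q) hlm (by omega) ⟨by omega, hcon.le⟩
      have hvert : P l 0 = P (l + 1) 0 := by
        by_contra hne
        have hy := (hP.rectilinear l).resolve_left hne
        have hx := lt_of_le_of_ne (hP.coord_zero_le l) hne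
        have := habove (l + 1) l.lt_succ_self hlk
        nlinarith
      set q : Plane := pt (P l 0) (P k 1 - s / 2 * (P k 0 - P l 0)) with hq
      have hq0 : q 0 = P l 0 := by simp [hq]
      have hq1 : q 1 = P k 1 - s / 2 * (P k 0 - P l 0) := by simp [hq]
      have hlkx := hP.mono_zero hlk.le
      have hql : P l 1 ≤ q 1 := by linarith
      have hql' : q 1 ≤ P (l + 1) 1 := by
        have := habove (l + 1) (by omega) hlk
        rw [← hvert] at this
        linarith
      obtain ⟨E₁, hE₁, -, h₁⟩ := ih i l hil (by omega)
      obtain ⟨E₂, -, hE₂, h₂⟩ := ih (l + 1) k hlk (by omega)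
      obtain ⟨E₃, hE₃, h₃⟩ := hP.exists_descent_to_line hs (l + 1) k hlk
      have hqk : s / 2 * (P k 0 - P l 0) = P k 1 - q 1 := by rw [hq1]; ring
      have hsx : 0 ≤ s * (P k 0 - P l 0) := mul_nonneg hs0.le (sub_nonneg.2 hlkx)
      have hweight : gweight (E₁ ∪ (E₂ ∪ (E₃ ∪ {(P k, q)}))) ≤ 40 * s * (P k 0 - P i 0) := by
        have g1 := gweight_union_le E₁ (E₂ ∪ (E₃ ∪ {(P k, q)}))
        have g2 := gweight_union_le E₂ (E₃ ∪ {(P k, q)})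
        have g3 := gweight_union_le E₃ {(P k, q)}
        rw [gweight_singleton] at g3
        have g4 := norm_sub_le_coord_add (p := P k) (q := q) (by rw [hq0]; exact hlkx)
          (by linarith)
        rw [← hvert] at hE₃
        nlinarith
      refine ⟨E₁ ∪ (E₂ ∪ (E₃ ∪ {(P k, q)})), hweight, hweight.trans (by nlinarith),
        fun a b hia hab hbk hpair => ?_⟩
      simp only [segUnion_union]
      rcases le_or_gt b l with hbl | hbl
      · exact (h₁ a b hia hab hbl hpair).mono
          (Set.union_subset_union_right _ Set.subset_union_left)
      rcases lt_or_ge l a with hla | hla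
      · exact (h₂ a b hla hab hbk hpair).mono (Set.union_subset_union_right _
          (Set.subset_union_left.trans Set.subset_union_right))
      have hpath₁ := (h₁ a l hia hla le_rfl fun m hm hm' => hpair m hm (by omega)).mono
        (Set.union_subset_union_right U (Set.subset_union_left
          (t := segUnion E₂ ∪ (segUnion E₃ ∪ segUnion {(P k, q)}))))
      obtain ⟨t, ht0, ht1, hd⟩ := h₃ b hbl hbk
      replace hd := hd.mono (V := U ∪ (segUnion E₁ ∪ (segUnion E₂ ∪ (segUnion E₃ ∪
        segUnion {(P k, q)})))) (Set.union_subset_union_right _ (Set.subset_union_left.trans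
          (Set.subset_union_right.trans Set.subset_union_right)))
      have hbx := hP.mono_zero hbl.le
      have hbkx := hP.mono_zero hbk
      have hlast : ∀ z : Plane, z 0 = P l 0 → P l 1 ≤ z 1 → z 1 ≤ P (l + 1) 1 →
          Descends (U ∪ (segUnion E₁ ∪ (segUnion E₂ ∪ (segUnion E₃ ∪
            segUnion {(P k, q)})))) z (P a) (7 * (P l 0 - P a 0) / s) := by
        intro z hz0 hz1 hz2
        rw [← zero_add (7 * (P l 0 - P a 0) / s)]
        refine .trans (.vertical ?_ hz0.symm hz1) hpath₁
        exact ((segment_subset_segment (mem_segment_vertical hvert hz0 hz1 hz2)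
          (left_mem_segment ℝ _ _)).trans (hP.segment_subset l)).trans Set.subset_union_left
      rcases le_total (q 1) (t 1) with hqt | hqt
      · refine (hd.trans (hlast t (by rw [ht0, hvert]) (hql.trans hqt) ht1)).weaken ?_
        rw [← add_div, ← hvert]
        exact div_le_div_of_nonneg_right (by linarith) hs0.le
      · obtain ⟨z, hz, hzq, hz0⟩ := hd.exists_crossing (s / 2) (P k 1 - s / 2 * P k 0)
          (habove b hbl hbk) (by rw [ht0, ← hvert]; linarith)
        rw [ht0, ← hvert] at hz0
        have hzb := hz.coord_zero_le
        have hzseg : segment ℝ z q ⊆ segUnion {(P k, q)} := by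
          refine (segment_subset_segment ?_ (right_mem_segment ℝ _ _)).trans
            (segment_subset_segUnion_singleton _ _)
          rcases eq_or_lt_of_le hlkx with he | hl'
          · have hz0' : z 0 = P k 0 := by linarith
            have : z = P k := plane_ext hz0' (by rw [hz0'] at hzq; linarith)
            rw [this]
            exact left_mem_segment ℝ _ _
          · have hpos : 0 < P k 0 - P l 0 := sub_pos.2 hl'
            refine mem_segment_of_coord ((P k 0 - z 0) / (P k 0 - P l 0))
              (div_nonneg (by linarith) hpos.le) ((div_le_one hpos).2 (by linarith)) ?_ ?_
            · rw [hq0]; field_simp; ring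
            · rw [hq1, show z 1 = P k 1 - s / 2 * P k 0 + s / 2 * z 0 by linarith]
              field_simp; ring
        have hzd : Descends (U ∪ (segUnion E₁ ∪ (segUnion E₂ ∪ (segUnion E₃ ∪
            segUnion {(P k, q)})))) z q ((z 0 - q 0) / (s / 2)) := by
          refine .steep (by linarith) (hzseg.trans ?_) (by rw [hq0]; exact hz0)
            (by rw [hq0]; linarith)
          exact Set.subset_union_right.trans (Set.subset_union_right.trans
            (Set.subset_union_right.trans Set.subset_union_right))
        refine (hz.trans (hzd.trans (hlast q hq0 hql hql'))).weaken ?_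
        rw [show (z 0 - q 0) / (s / 2) = 2 * (z 0 - q 0) / s by field_simp, ← add_div, ← add_div,
          ← hvert, hq0]
        exact div_le_div_of_nonneg_right (by linarith) hs0.le
    · push Not at hroot
      have hfind := Nat.find_spec hroot
      set j := Nat.find hroot with hj
      obtain ⟨hij, hjk, hlow⟩ := hfind
      have hmin : ∀ m, i ≤ m → m < j → P i 1 - s * P i 0 ≤ P m 1 - s * P m 0 := by
        intro m him hmj
        by_contra! hcon
        exact Nat.find_min hroot hmj ⟨him, by omega, hcon⟩
      have hij' : i < j := lt_of_le_of_ne hij (by rintro he; rw [← he] at hlow; exact hlow.false)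
      obtain ⟨l, hl⟩ : ∃ l, j = l + 1 := ⟨j - 1, by omega⟩
      clear_value j
      subst hl
      obtain ⟨E₁, hE₁, hE₁', h₁⟩ := ih i l (by omega) (by omega)
      obtain ⟨E₂, hE₂, hE₂', h₂⟩ := ih (l + 1) k hjk (by omega)
      have g := gweight_union_le E₁ E₂
      have hx := hP.coord_zero_le l
      have hy := hP.coord_one_le l
      refine ⟨E₁ ∪ E₂, by nlinarith, by linarith, fun a b hia hab hbk hpair => ?_⟩
      rw [segUnion_union]
      rcases le_or_gt b l with hbl | hbl
      · exact (h₁ a b hia hab hbl hpair).mono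
          (Set.union_subset_union_right _ Set.subset_union_left)
      rcases lt_or_ge l a with hla | hla
      · exact (h₂ a b hla hab hbk hpair).mono
          (Set.union_subset_union_right _ Set.subset_union_right)
      · exact absurd (hmin a hia (by omega))
          (not_le.2 ((hpair (l + 1) (by omega) hbl).trans_lt hlow))

end StairSeq

/-! ### Refining a staircase -/

/-- Inserting a point of the `j`-th edge into a sequence. -/
def insertAfter (P : ℕ → Plane) (j : ℕ) (p : Plane) (i : ℕ) : Plane :=
  if i ≤ j then P i else if i = j + 1 then p else P (i - 1)

lemma insertAfter_of_le {P : ℕ → Plane} {j i : ℕ} {p : Plane} (h : i ≤ j) :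
    insertAfter P j p i = P i := if_pos h

lemma insertAfter_self (P : ℕ → Plane) (j : ℕ) (p : Plane) :
    insertAfter P j p (j + 1) = p := by simp [insertAfter]

lemma insertAfter_succ_of_lt {P : ℕ → Plane} {j i : ℕ} {p : Plane} (h : j < i) :
    insertAfter P j p (i + 1) = P i := by
  rw [insertAfter, if_neg (by omega), if_neg (by omega), Nat.add_sub_cancel]

lemma segment_subset_union_of_mem {p q z : Plane} (hz : z ∈ segment ℝ p q) :
    segment ℝ p q ⊆ segment ℝ p z ∪ segment ℝ z q := by
  intro r hr
  obtain ⟨t, ht0, ht1, hz0, hz1⟩ := coord_of_mem_segment hz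
  obtain ⟨u, hu0, hu1, hr0, hr1⟩ := coord_of_mem_segment hr
  rcases le_total u t with hut | hut
  · left
    rcases eq_or_lt_of_le ht0 with he | hl
    · have : u = t := by linarith
      subst this
      exact mem_segment_of_coord 1 zero_le_one le_rfl (by linarith) (by linarith)
    · refine mem_segment_of_coord (u / t) (div_nonneg hu0 ht0) ((div_le_one hl).2 hut) ?_ ?_
      · rw [hr0, hz0]; field_simp; ring
      · rw [hr1, hz1]; field_simp; ring
  · right
    rcases eq_or_lt_of_le ht1 with he | hl
    · have : u = t := by linarith
      subst this
      exact mem_segment_of_coord 0 le_rfl zero_le_one (by linarith) (by linarith)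
    · have hpos : 0 < 1 - t := sub_pos.2 hl
      refine mem_segment_of_coord ((u - t) / (1 - t)) (div_nonneg (by linarith) hpos.le)
        ((div_le_one hpos).2 (by linarith)) ?_ ?_
      · rw [hr0, hz0]; field_simp; ring
      · rw [hr1, hz1]; field_simp; ring

lemma StairSeq.insertAfter {P : ℕ → Plane} {U : Set Plane} (h : StairSeq P U) {j : ℕ}
    {p : Plane} (hp : p ∈ segment ℝ (P j) (P (j + 1))) : StairSeq (insertAfter P j p) U := by
  obtain ⟨⟨hp0, hp0'⟩, hp1, hp1'⟩ :=
    coord_mem_of_mem_segment hp (h.coord_zero_le j) (h.coord_one_le j)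
  have key : ∀ i, segment ℝ (_root_.insertAfter P j p i) (_root_.insertAfter P j p (i + 1)) ⊆ U ∧
      _root_.insertAfter P j p i 0 ≤ _root_.insertAfter P j p (i + 1) 0 ∧
      _root_.insertAfter P j p i 1 ≤ _root_.insertAfter P j p (i + 1) 1 ∧
      (_root_.insertAfter P j p i 0 = _root_.insertAfter P j p (i + 1) 0 ∨
        _root_.insertAfter P j p i 1 = _root_.insertAfter P j p (i + 1) 1) := by
    intro i
    have hrect := h.rectilinear j
    rcases lt_trichotomy i j with hij | rfl | hij
    · rw [insertAfter_of_le hij.le, insertAfter_of_le (show i + 1 ≤ j from hij)]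
      exact ⟨h.segment_subset i, h.coord_zero_le i, h.coord_one_le i, h.rectilinear i⟩
    · rw [insertAfter_of_le le_rfl, insertAfter_self]
      refine ⟨(segment_subset_segment (left_mem_segment ℝ _ _) hp).trans (h.segment_subset i),
        hp0, hp1, hrect.imp (fun he => ?_) fun he => ?_⟩ <;> linarith
    · obtain ⟨i, rfl⟩ : ∃ l, i = l + 1 := ⟨i - 1, by omega⟩
      rw [insertAfter_succ_of_lt (show j < i + 1 from hij)]
      rcases eq_or_lt_of_le (Nat.lt_succ_iff.1 hij) with rfl | hij
      · rw [insertAfter_self]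
        refine ⟨(segment_subset_segment hp (right_mem_segment ℝ _ _)).trans
          (h.segment_subset j), hp0', hp1', hrect.imp (fun he => ?_) fun he => ?_⟩ <;> linarith
      · rw [insertAfter_succ_of_lt hij]
        exact ⟨h.segment_subset i, h.coord_zero_le i, h.coord_one_le i, h.rectilinear i⟩
  exact ⟨fun i => (key i).1, fun i => (key i).2.1, fun i => (key i).2.2.1,
    fun i => (key i).2.2.2⟩

/-- A staircase through a finite set `S` of its points. -/
lemma exists_refinement {n : ℕ} {u : ℕ → Plane} (hu : IsStaircase n u) (hn : 0 < n)
    (S : Finset Plane) (hS : ↑S ⊆ pathSet n u) :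
    ∃ P : ℕ → Plane, StairSeq P (pathSet n u) ∧ P 0 = u 0 ∧ (∃ N, ∀ i, N ≤ i → P i = u n) ∧
      (∀ p ∈ pathSet n u, ∃ i, p ∈ segment ℝ (P i) (P (i + 1))) ∧ ∀ p ∈ S, ∃ i, P i = p := by
  induction S using Finset.induction_on with
  | empty =>
    refine ⟨fun i => u (min i n), ?_, by simp, ⟨n, fun i hi => by simp [hi]⟩, ?_, by simp⟩
    · have hend : ∀ i, n ≤ i → u (min i n) = u (min (i + 1) n) := fun i hi => by
        rw [min_eq_right hi, min_eq_right (by omega)]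
      have hmid : ∀ i < n, min i n = i ∧ min (i + 1) n = i + 1 := fun i hi => by omega
      refine ⟨fun i => ?_, fun i => ?_, fun i => ?_, fun i => ?_⟩ <;>
        rcases lt_or_ge i n with hi | hi
      · simp only [(hmid i hi).1, (hmid i hi).2]
        exact Set.subset_biUnion_of_mem (u := fun i => segment ℝ (u i) (u (i + 1)))
          (Finset.mem_coe.2 (Finset.mem_range.2 hi))
      · simp only [← hend i hi, segment_same, min_eq_right hi, Set.singleton_subset_iff]
        refine Set.mem_biUnion (x := n - 1) (Finset.mem_coe.2 (Finset.mem_range.2 (by omega))) ?_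
        rw [Nat.sub_add_cancel hn]
        exact right_mem_segment ℝ _ _
      · simp only [(hmid i hi).1, (hmid i hi).2]
        exact (hu.2 i hi).1
      · simp only [← hend i hi]; exact le_rfl
      · simp only [(hmid i hi).1, (hmid i hi).2]
        exact (hu.2 i hi).2
      · simp only [← hend i hi]; exact le_rfl
      · simp only [(hmid i hi).1, (hmid i hi).2]
        exact hu.1 i hi
      · simp only [← hend i hi]; simp
    · intro p hp
      simp only [pathSet, Set.mem_iUnion, Finset.mem_range] at hp
      obtain ⟨i, hi, hp⟩ := hp
      refine ⟨i, ?_⟩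
      simpa only [min_eq_left hi.le, min_eq_left (show i + 1 ≤ n from hi)] using hp
  | insert a S _ ih =>
    obtain ⟨P, hP, h0, ⟨N, hN⟩, hcov, hSP⟩ := ih
      (Set.Subset.trans (by simp) hS)
    obtain ⟨j, hj⟩ := hcov a (hS (by simp))
    refine ⟨insertAfter P j a, hP.insertAfter hj, by rw [insertAfter_of_le (Nat.zero_le j), h0],
      ⟨max N (j + 1) + 1, fun i hi => ?_⟩, fun p hp => ?_, fun p hp => ?_⟩
    · obtain ⟨i, rfl⟩ : ∃ l, i = l + 1 := ⟨i - 1, by omega⟩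
      rw [insertAfter_succ_of_lt (by omega), hN i (by omega)]
    · obtain ⟨i, hi⟩ := hcov p hp
      rcases lt_trichotomy i j with hij | rfl | hij
      · refine ⟨i, ?_⟩
        rwa [insertAfter_of_le hij.le, insertAfter_of_le (show i + 1 ≤ j from hij)]
      · rcases segment_subset_union_of_mem hj hi with h | h
        · refine ⟨i, ?_⟩
          rwa [insertAfter_of_le le_rfl, insertAfter_self]
        · refine ⟨i + 1, ?_⟩
          rwa [insertAfter_self, insertAfter_succ_of_lt i.lt_succ_self]
      · refine ⟨i + 1, ?_⟩
        rwa [insertAfter_succ_of_lt hij, insertAfter_succ_of_lt (by omega)]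
    · have hexists : ∀ i, ∃ l, insertAfter P j a l = P i := fun i => by
        rcases le_or_gt i j with hij | hij
        · exact ⟨i, insertAfter_of_le hij⟩
        · exact ⟨i + 1, insertAfter_succ_of_lt hij⟩
      rcases Finset.mem_insert.1 hp with rfl | hp
      · exact ⟨j + 1, insertAfter_self _ _ _⟩
      · obtain ⟨i, rfl⟩ := hSP p hp
        exact hexists i

/-- If a chord of slope at least `s` lies below the staircase, the staircase between its
endpoints lies above the line of slope `s` through its lower endpoint. -/
lemma StairSeq.above_of_chord_below {P : ℕ → Plane} {L : Set Plane} (hP : StairSeq P L)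
    (hcov : ∀ p ∈ L, ∃ i, p ∈ segment ℝ (P i) (P (i + 1))) {s : ℝ} {a b : ℕ}
    (hseg : segment ℝ (P a) (P b) ⊆ belowRegion L)
    (hslope : s * (P b 0 - P a 0) ≤ P b 1 - P a 1) {m : ℕ} (ham : a ≤ m) (hmb : m ≤ b) :
    P a 1 - s * P a 0 ≤ P m 1 - s * P m 0 := by
  by_contra! hcon
  have hx1 := hP.mono_zero ham
  have hx2 := hP.mono_zero hmb
  have hy1 := hP.mono_one ham
  have hy2 := hP.mono_one hmb
  have hxlt : P a 0 < P m 0 := by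
    refine lt_of_le_of_ne hx1 fun he => ?_
    rw [he] at hcon
    linarith
  set dx := P b 0 - P a 0 with hdx
  set dy := P b 1 - P a 1 with hdy
  have hdx0 : 0 < dx := by linarith
  set t := (P m 0 - P a 0) / dx with ht
  have htdx : t * dx = P m 0 - P a 0 := by rw [ht]; field_simp
  have ht0 : 0 < t := div_pos (by linarith) hdx0
  have ht1 : t ≤ 1 := (div_le_one hdx0).2 (by linarith)
  have hchord : P m 1 - P a 1 < t * dy := by
    have := mul_le_mul_of_nonneg_left hslope ht0.le
    nlinarith
  have hdy0 : 0 < dy := by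
    by_contra! h
    nlinarith
  set r := (P m 1 - P a 1) / dy with hr
  have hrdy : r * dy = P m 1 - P a 1 := by rw [hr]; field_simp
  have hr0 : 0 ≤ r := div_nonneg (by linarith) hdy0.le
  have hrt : r < t := by
    by_contra! h
    nlinarith
  have hz : pt (P a 0 + (r + t) / 2 * dx) (P a 1 + (r + t) / 2 * dy) ∈
      segment ℝ (P a) (P b) :=
    mem_segment_of_coord ((r + t) / 2) (by linarith) (by linarith) (by simp [hdx]) (by simp [hdy])
  obtain ⟨⟨q, hqL, hq0, hq1⟩, -⟩ := hseg hz
  rw [pt_zero] at hq0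
  rw [pt_one] at hq1
  obtain ⟨j, hj⟩ := hcov q hqL
  obtain ⟨⟨hj0, -⟩, -, hj1⟩ :=
    coord_mem_of_mem_segment hj (hP.coord_zero_le j) (hP.coord_one_le j)
  rcases le_or_gt m j with hmj | hmj
  · have := hP.mono_zero hmj
    nlinarith
  · have := hP.mono_one (show j + 1 ≤ m from hmj)
    nlinarith

-- **Statement 13.** (Directional spanners for staircases.) There is an absolute constant
-- `C > 0` such that for every `ε ∈ (0,1]`, every staircase path `L`, and every finite
-- `S ⊂ L`, there is a geometric graph comprised of the edges of `L` and additional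
-- segments of total weight at most `C·ε^{-1/2}·width(L)` containing, for all `a, b ∈ S`
-- such that `ab` lies below `L` and `|x(a) − x(b)| ≤ ε^{1/2}·|y(a) − y(b)|`, an
-- `ab`-path of weight at most `(1 + C·ε)·‖a − b‖`.
theorem directional_spanner_staircase :
    ∃ C : ℝ, 0 < C ∧
      ∀ ε : ℝ, 0 < ε → ε ≤ 1 →
      ∀ (n : ℕ) (u : ℕ → Plane), IsStaircase n u →
      ∀ S : Finset Plane, ↑S ⊆ pathSet n u →
        ∃ Ex : Finset (Plane × Plane),
          gweight Ex ≤ C * (Real.sqrt ε)⁻¹ * (u n 0 - u 0 0) ∧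
          ∀ a ∈ S, ∀ b ∈ S,
            segment ℝ a b ⊆ belowRegion (pathSet n u) →
            |a 0 - b 0| ≤ Real.sqrt ε * |a 1 - b 1| →
            HasPath (pathEdges n u ∪ Ex) a b ((1 + C * ε) * ‖a - b‖) := by
  refine ⟨40, by norm_num, fun ε hε hε1 n u hu S hS => ?_⟩
  set σ := Real.sqrt ε with hσ
  have hσ0 : 0 < σ := Real.sqrt_pos.2 hε
  have hσ1 : σ ≤ 1 := Real.sqrt_le_one.2 hε1
  have hσε : σ * σ = ε := Real.mul_self_sqrt hε.le
  rcases Nat.eq_zero_or_pos n with rfl | hn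
  · refine ⟨∅, by simp, fun a ha => ?_⟩
    have := hS ha
    simp [pathSet] at this
  obtain ⟨P, hP, hP0, ⟨N, hN⟩, hcov, hSP⟩ := exists_refinement hu hn S hS
  have hs : 1 ≤ σ⁻¹ := (one_le_inv₀ hσ0).2 hσ1
  obtain ⟨Ex, hE, -, hpath⟩ := hP.exists_spanner hs N 0 N (Nat.zero_le N) (by omega)
  refine ⟨Ex, by rwa [hN N le_rfl, hP0] at hE, ?_⟩
  have hidx : ∀ p ∈ S, ∃ i ≤ N, P i = p := fun p hp => by
    obtain ⟨i, rfl⟩ := hSP p hp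
    rcases le_total i N with hi | hi
    · exact ⟨i, hi, rfl⟩
    · exact ⟨N, le_rfl, by rw [hN i hi, hN N le_rfl]⟩
  have main : ∀ i k, i ≤ k → k ≤ N → segment ℝ (P i) (P k) ⊆ belowRegion (pathSet n u) →
      |P i 0 - P k 0| ≤ σ * |P i 1 - P k 1| →
      HasPath (pathEdges n u ∪ Ex) (P k) (P i) ((1 + 40 * ε) * ‖P k - P i‖) := by
    intro i k hik hkN hseg hslope
    have hx := hP.mono_zero hik
    have hy := hP.mono_one hik
    rw [abs_sub_comm, abs_of_nonneg (sub_nonneg.2 hx), abs_sub_comm,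
      abs_of_nonneg (sub_nonneg.2 hy)] at hslope
    have hslope' : σ⁻¹ * (P k 0 - P i 0) ≤ P k 1 - P i 1 := (inv_mul_le_iff₀ hσ0).2 hslope
    have hd := hpath i k (Nat.zero_le i) hik hkN fun m him hmk =>
      hP.above_of_chord_below hcov hseg hslope' him hmk
    rw [← segUnion_pathEdges, ← segUnion_union] at hd
    obtain ⟨m, v, h0, hm, hvs, hw⟩ := hd.hasPath
    refine ⟨m, v, h0, hm, hvs, hw.trans ?_⟩
    have hlen := sub_coord_one_le_norm (P k) (P i)
    rw [div_inv_eq_mul]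
    have h1 := mul_le_mul_of_nonneg_right hslope hσ0.le
    have h2 : σ * (P k 1 - P i 1) * σ = ε * (P k 1 - P i 1) := by rw [← hσε]; ring
    have h3 := mul_le_mul_of_nonneg_left hlen hε.le
    have h4 := mul_nonneg hε.le (norm_nonneg (P k - P i))
    linarith
  intro a ha b hb hseg hslope
  obtain ⟨i, hi, rfl⟩ := hidx a ha
  obtain ⟨k, hk, rfl⟩ := hidx b hb
  rcases le_total i k with hik | hik
  · rw [norm_sub_rev]
    exact (main i k hik hk hseg hslope).symm
  · rw [segment_symm] at hseg
    rw [abs_sub_comm, abs_sub_comm (P i 1)] at hslope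
    exact main k i hik hi hseg hslope

end
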